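/- arXiv:2411.07825 — 2 statements merged into one kernel-verified Lean document; each statement's English description precedes it below -/
import Mathlib

section
/- Let K₀ be any m×n real matrix, b > 0 with (1/b)(A − BK₀) Schur stable, c₀ = 1, and γ_i = (∏_{j=0}^{i} c_j)/b. Suppose there is an index î with ∏_{j=0}^{î} c_j ≥ b, and that the sequences (P_i), (K_i), (c_i) satisfy: for 0 ≤ i < î, P_i is the symmetric positive definite solution of γ_i²(A − BK_i)ᵀP_i(A − BK_i) − P_i + Q + K_iᵀRK_i = 0, K_{i+1} = (BᵀP_iB + (1/γ_i²)R)⁻¹BᵀP_iA, and c_{i+1} > 1 is such that c_{i+1}γ_i(A − BK_{i+1}) is Schur stable; while for i ≥ î the iteration proceeds with scale factor 1: P_i is the symmetric solution of P_i = Q + K_iᵀRK_i + (A − BK_i)ᵀP_i(A − BK_i) and K_{i+1} = (R + BᵀP_iB)⁻¹BᵀP_iA. If P★ is the symmetric positive definite solution of the ARE, then the sequence P_i converges entrywise to P★ as i → ∞. -/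
open Matrix Filter Finset

/-- A real square matrix is Schur stable if every eigenvalue of it, viewed as a
complex matrix, has modulus strictly less than `1`. -/
def SchurStable {n : ℕ} (M : Matrix (Fin n) (Fin n) ℝ) : Prop :=
  ∀ μ ∈ spectrum ℂ (M.map (algebraMap ℝ ℂ)), ‖μ‖ < 1

section PowersTendstoZero

attribute [local instance] Matrix.linftyOpNormedRing Matrix.linftyOpNormedAlgebra

theorem tendsto_pow_of_forall_spectrum_lt_one {n : ℕ} (M : Matrix (Fin n) (Fin n) ℂ)
    (h : ∀ μ ∈ spectrum ℂ M, ‖μ‖ < 1) : Tendsto (fun k => M ^ k) atTop (nhds 0) := by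
  rcases Nat.eq_zero_or_pos n with rfl | hn
  · have : (fun k => M ^ k) = fun _ => 0 := funext fun k => Subsingleton.elim _ _
    rw [this]
    exact tendsto_const_nhds
  have : Nonempty (Fin n) := ⟨⟨0, hn⟩⟩
  have : CompleteSpace (Matrix (Fin n) (Fin n) ℂ) := FiniteDimensional.complete ℂ _
  have hlt : spectralRadius ℂ M < (1 : NNReal) :=
    spectrum.spectralRadius_lt_of_forall_lt M fun z hz => h z hz
  obtain ⟨r, hr, hr1⟩ := ENNReal.lt_iff_exists_nnreal_btwn.1 hlt
  have hG := spectrum.pow_nnnorm_pow_one_div_tendsto_nhds_spectralRadius M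
  have hev := hG.eventually (gt_mem_nhds hr)
  have hr1' : (r : ℝ) < 1 := by exact_mod_cast hr1
  refine tendsto_zero_iff_norm_tendsto_zero.2 ?_
  refine squeeze_zero' (Eventually.of_forall fun _ => norm_nonneg _) ?_
    (tendsto_pow_atTop_nhds_zero_of_lt_one r.2 hr1')
  filter_upwards [hev, eventually_gt_atTop 0] with k hk hk0
  have hk' : (0 : ℝ) < k := by exact_mod_cast hk0
  have h2 := ENNReal.rpow_le_rpow hk.le hk'.le
  rw [← ENNReal.rpow_mul, one_div, inv_mul_cancel₀ hk'.ne', ENNReal.rpow_one,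
    ENNReal.rpow_natCast] at h2
  exact_mod_cast h2

end PowersTendstoZero

/-- All orbits of the linear map given by `M` converge to zero. -/
def OrbitsVanish {n : ℕ} (M : Matrix (Fin n) (Fin n) ℝ) : Prop :=
  ∀ x : Fin n → ℝ, Tendsto (fun k => (M ^ k) *ᵥ x) atTop (nhds 0)

theorem SchurStable.orbitsVanish {n : ℕ} {M : Matrix (Fin n) (Fin n) ℝ} (h : SchurStable M) :
    OrbitsVanish M := by
  intro x
  have h1 := tendsto_pow_of_forall_spectrum_lt_one _ h
  have hij : ∀ i j, Tendsto (fun k => (M ^ k) i j) atTop (nhds 0) := by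
    intro i j
    have h2 : Tendsto (fun k => ((M.map (algebraMap ℝ ℂ)) ^ k) i j) atTop (nhds 0) :=
      tendsto_pi_nhds.1 (tendsto_pi_nhds.1 h1 i) j
    have h3 : ∀ k, ((M.map (algebraMap ℝ ℂ)) ^ k) i j = (((M ^ k) i j : ℝ) : ℂ) := by
      intro k
      rw [← Matrix.map_pow]
      rfl
    simp only [h3] at h2
    exact_mod_cast (Complex.continuous_re.tendsto _).comp h2
  rw [tendsto_pi_nhds]
  intro i
  have : Tendsto (fun k => ∑ j, (M ^ k) i j * x j) atTop (nhds (∑ j, 0 * x j)) :=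
    tendsto_finsetSum _ fun j _ => (hij i j).mul_const _
  simpa [Matrix.mulVec, dotProduct] using this

theorem OrbitsVanish.of_smul {n : ℕ} {M : Matrix (Fin n) (Fin n) ℝ} {r : ℝ} (hr : 1 ≤ r)
    (h : OrbitsVanish (r • M)) : OrbitsVanish M := by
  intro x
  have h1 := tendsto_zero_iff_norm_tendsto_zero.1 (h x)
  rw [tendsto_zero_iff_norm_tendsto_zero]
  refine squeeze_zero (fun _ => norm_nonneg _) (fun k => ?_) h1
  rw [smul_pow, smul_mulVec, norm_smul, Real.norm_eq_abs]
  exact le_mul_of_one_le_left (norm_nonneg _) ((one_le_pow₀ hr).trans (le_abs_self _))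

theorem dotProduct_transpose_mul_mul {n m : ℕ} (X : Matrix (Fin m) (Fin m) ℝ)
    (M : Matrix (Fin m) (Fin n) ℝ) (x y : Fin n → ℝ) :
    x ⬝ᵥ ((Mᵀ * X * M) *ᵥ y) = (M *ᵥ x) ⬝ᵥ (X *ᵥ (M *ᵥ y)) := by
  rw [← mulVec_mulVec, ← mulVec_mulVec, dotProduct_mulVec, vecMul_transpose]

theorem Matrix.PosSemidef.quadForm_nonneg {n : ℕ} {X : Matrix (Fin n) (Fin n) ℝ}
    (h : X.PosSemidef) (x : Fin n → ℝ) : 0 ≤ x ⬝ᵥ (X *ᵥ x) := by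
  simpa using h.dotProduct_mulVec_nonneg x

theorem Matrix.PosSemidef.isSymm {n : ℕ} {X : Matrix (Fin n) (Fin n) ℝ}
    (h : X.PosSemidef) : X.IsSymm := by
  simpa [IsHermitian, IsSymm] using h.isHermitian

theorem transpose_mul_sub_mul {n m : ℕ} (X Y : Matrix (Fin m) (Fin m) ℝ)
    (M : Matrix (Fin m) (Fin n) ℝ) : Mᵀ * (X - Y) * M = Mᵀ * X * M - Mᵀ * Y * M := by
  rw [Matrix.mul_sub, Matrix.sub_mul]

theorem Matrix.PosSemidef.transpose_mul_mul_same {n m : ℕ} {X : Matrix (Fin m) (Fin m) ℝ}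
    (h : X.PosSemidef) (M : Matrix (Fin m) (Fin n) ℝ) : (Mᵀ * X * M).PosSemidef := by
  simpa [conjTranspose_eq_transpose_of_trivial] using h.conjTranspose_mul_mul_same M

theorem OrbitsVanish.tendsto_bilin {n : ℕ} {M : Matrix (Fin n) (Fin n) ℝ}
    (h : OrbitsVanish M) (X : Matrix (Fin n) (Fin n) ℝ) (x : Fin n → ℝ) :
    Tendsto (fun k => ((M ^ k) *ᵥ x) ⬝ᵥ (X *ᵥ ((M ^ k) *ᵥ x))) atTop (nhds 0) := by
  have hc : Continuous fun y : Fin n → ℝ => y ⬝ᵥ (X *ᵥ y) := by fun_prop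
  have hlim := (hc.tendsto 0).comp (h x)
  rwa [zero_dotProduct] at hlim

/-- A symmetric solution of a Stein equation with stable coefficient and positive semidefinite
right-hand side is positive semidefinite. -/
theorem OrbitsVanish.posSemidef_of_stein {n : ℕ} {M X W : Matrix (Fin n) (Fin n) ℝ}
    (h : OrbitsVanish M) (hX : X.IsSymm) (hW : W.PosSemidef) (heq : X = Mᵀ * X * M + W) :
    X.PosSemidef := by
  refine .of_dotProduct_mulVec_nonneg (by simpa [IsHermitian, IsSymm] using hX) fun x => ?_
  have hstep : ∀ y : Fin n → ℝ, (M *ᵥ y) ⬝ᵥ (X *ᵥ (M *ᵥ y)) ≤ y ⬝ᵥ (X *ᵥ y) := by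
    intro y
    conv_rhs => rw [heq]
    rw [add_mulVec, dotProduct_add, dotProduct_transpose_mul_mul]
    linarith [hW.quadForm_nonneg y]
  have hk : ∀ k, ((M ^ k) *ᵥ x) ⬝ᵥ (X *ᵥ ((M ^ k) *ᵥ x)) ≤ x ⬝ᵥ (X *ᵥ x) := by
    intro k
    induction k with
    | zero => simp
    | succ k ih =>
      rw [pow_succ', ← mulVec_mulVec]
      exact (hstep _).trans ih
  simpa using le_of_tendsto (h.tendsto_bilin X x) (Eventually.of_forall hk)

theorem Matrix.PosSemidef.mulVec_eq_zero_of_quadForm {n : ℕ} {X : Matrix (Fin n) (Fin n) ℝ}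
    (h : X.PosSemidef) {x : Fin n → ℝ} (hx : x ⬝ᵥ (X *ᵥ x) = 0) : X *ᵥ x = 0 :=
  (h.dotProduct_mulVec_zero_iff x).1 (by simpa using hx)

theorem quadForm_add_quadForm_rotate {n : ℕ} (X : Matrix (Fin n) (Fin n) ℝ)
    (x y : Fin n → ℝ) (a b : ℝ) :
    (a • x - b • y) ⬝ᵥ (X *ᵥ (a • x - b • y)) + (b • x + a • y) ⬝ᵥ (X *ᵥ (b • x + a • y))
      = (a ^ 2 + b ^ 2) * (x ⬝ᵥ (X *ᵥ x) + y ⬝ᵥ (X *ᵥ y)) := by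
  simp only [mulVec_sub, mulVec_add, mulVec_smul, sub_dotProduct, add_dotProduct, dotProduct_sub,
    dotProduct_add, smul_dotProduct, dotProduct_smul, smul_eq_mul]
  ring

/-- A real matrix with a complex eigenvalue `a + b i` acts on some nonzero pair of real vectors
as the corresponding rotation-scaling. -/
theorem exists_real_pair_of_mem_spectrum {n : ℕ} {M : Matrix (Fin n) (Fin n) ℝ} {μ : ℂ}
    (hμ : μ ∈ spectrum ℂ (M.map (algebraMap ℝ ℂ))) :
    ∃ x y : Fin n → ℝ, (x ≠ 0 ∨ y ≠ 0) ∧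
      M *ᵥ x = μ.re • x - μ.im • y ∧ M *ᵥ y = μ.im • x + μ.re • y := by
  rw [← spectrum_toLin', ← Module.End.hasEigenvalue_iff_mem_spectrum] at hμ
  obtain ⟨v, hv⟩ := hμ.exists_hasEigenvector
  have hv1 : (M.map (algebraMap ℝ ℂ)) *ᵥ v = μ • v := by simpa using hv.apply_eq_smul
  refine ⟨fun i => (v i).re, fun i => (v i).im, ?_, ?_, ?_⟩
  · by_contra! hne
    refine hv.2 (funext fun i => Complex.ext ?_ ?_)
    · exact congrFun hne.1 i
    · exact congrFun hne.2 i
  · funext i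
    have := congrArg Complex.re (congrFun hv1 i)
    simpa [mulVec, dotProduct] using this
  · funext i
    have := congrArg Complex.im (congrFun hv1 i)
    simpa [mulVec, dotProduct, add_comm] using this

/-- Lyapunov's criterion for a closed loop `A - B L` whose stage cost dominates
`Q + Lᵀ R L`, with `(A, Q)` observable. -/
theorem schurStable_closedLoop {n m : ℕ}
    {A : Matrix (Fin n) (Fin n) ℝ} {B : Matrix (Fin n) (Fin m) ℝ}
    {Q : Matrix (Fin n) (Fin n) ℝ} {R : Matrix (Fin m) (Fin m) ℝ}
    (hQ : Q.PosSemidef) (hR : R.PosDef)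
    (hObs : ∀ x : Fin n → ℝ, (∀ k : ℕ, Q.mulVec ((A ^ k).mulVec x) = 0) → x = 0)
    {L : Matrix (Fin m) (Fin n) ℝ} {P W : Matrix (Fin n) (Fin n) ℝ}
    (hP : P.PosDef) (hW : W.PosSemidef)
    (heq : P = Q + Lᵀ * R * L + (A - B * L)ᵀ * P * (A - B * L) + W) :
    SchurStable (A - B * L) := by
  intro μ hμ
  by_contra! hge
  obtain ⟨x, y, hxy, hx, hy⟩ := exists_real_pair_of_mem_spectrum hμ
  have hval : ∀ z : Fin n → ℝ, z ⬝ᵥ (P *ᵥ z) = z ⬝ᵥ (Q *ᵥ z) + (L *ᵥ z) ⬝ᵥ (R *ᵥ (L *ᵥ z))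
      + ((A - B * L) *ᵥ z) ⬝ᵥ (P *ᵥ ((A - B * L) *ᵥ z)) + z ⬝ᵥ (W *ᵥ z) := by
    intro z
    conv_lhs => rw [heq]
    simp only [add_mulVec, dotProduct_add, dotProduct_transpose_mul_mul]
  have hrot := quadForm_add_quadForm_rotate P x y μ.re μ.im
  rw [← hx, ← hy] at hrot
  have hsq : 1 ≤ μ.re ^ 2 + μ.im ^ 2 := by
    rw [← Complex.sq_norm_sub_sq_im μ]
    nlinarith [norm_nonneg μ]
  have hPx := hP.posSemidef.quadForm_nonneg x
  have hPy := hP.posSemidef.quadForm_nonneg y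
  have hQx := hQ.quadForm_nonneg x
  have hQy := hQ.quadForm_nonneg y
  have hRx := hR.posSemidef.quadForm_nonneg (L *ᵥ x)
  have hRy := hR.posSemidef.quadForm_nonneg (L *ᵥ y)
  have hWx := hW.quadForm_nonneg x
  have hWy := hW.quadForm_nonneg y
  have hvx := hval x
  have hvy := hval y
  have hmul := mul_le_mul_of_nonneg_right hsq (add_nonneg hPx hPy)
  have hzero : ∀ z : Fin n → ℝ, z ⬝ᵥ (Q *ᵥ z) = 0 → (L *ᵥ z) ⬝ᵥ (R *ᵥ (L *ᵥ z)) = 0 →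
      Q *ᵥ z = 0 ∧ A *ᵥ z = (A - B * L) *ᵥ z := by
    intro z h1 h2
    refine ⟨hQ.mulVec_eq_zero_of_quadForm h1, ?_⟩
    have hLz : L *ᵥ z = 0 := by
      by_contra hne
      have := hR.dotProduct_mulVec_pos hne
      simp only [star_trivial] at this
      linarith
    rw [sub_mulVec, ← mulVec_mulVec, hLz, mulVec_zero, sub_zero]
  obtain ⟨hQx0, hAx⟩ := hzero x (by linarith) (by linarith)
  obtain ⟨hQy0, hAy⟩ := hzero y (by linarith) (by linarith)
  rw [hx] at hAx
  rw [hy] at hAy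
  have hall : ∀ k : ℕ, ∀ a b : ℝ, Q *ᵥ ((A ^ k) *ᵥ (a • x + b • y)) = 0 := by
    intro k
    induction k with
    | zero => intro a b; simp [mulVec_add, mulVec_smul, hQx0, hQy0]
    | succ k ih =>
      intro a b
      rw [pow_succ, ← mulVec_mulVec, mulVec_add A, mulVec_smul A, mulVec_smul A, hAx, hAy]
      have hcomb : a • (μ.re • x - μ.im • y) + b • (μ.im • x + μ.re • y)
          = (a * μ.re + b * μ.im) • x + (b * μ.re - a * μ.im) • y := by module
      rw [hcomb]
      exact ih _ _
  rcases hxy with h | h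
  · exact h (hObs x fun k => by simpa using hall k 1 0)
  · exact h (hObs y fun k => by simpa using hall k 0 1)

/-- Completing the square in the policy-evaluation operator. -/
theorem policyCost_eq_add_sq {n m : ℕ}
    {A : Matrix (Fin n) (Fin n) ℝ} {B : Matrix (Fin n) (Fin m) ℝ}
    {Q : Matrix (Fin n) (Fin n) ℝ} {R : Matrix (Fin m) (Fin m) ℝ} (hR : R.IsSymm)
    {P : Matrix (Fin n) (Fin n) ℝ} (hP : P.IsSymm) {L : Matrix (Fin m) (Fin n) ℝ}
    (hL : (R + Bᵀ * P * B) * L = Bᵀ * P * A) (K : Matrix (Fin m) (Fin n) ℝ) :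
    Q + Kᵀ * R * K + (A - B * K)ᵀ * P * (A - B * K)
      = Q + Lᵀ * R * L + (A - B * L)ᵀ * P * (A - B * L)
        + (K - L)ᵀ * (R + Bᵀ * P * B) * (K - L) := by
  have hS : (R + Bᵀ * P * B)ᵀ = R + Bᵀ * P * B := by
    simp [transpose_mul, hR.eq, hP.eq, Matrix.mul_assoc]
  have hLT : Lᵀ * (R + Bᵀ * P * B) = Aᵀ * P * B := by
    have := congrArg transpose hL
    rw [transpose_mul, hS] at this
    simpa [transpose_mul, hP.eq, Matrix.mul_assoc] using this
  have expand : ∀ J : Matrix (Fin m) (Fin n) ℝ,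
      Q + Jᵀ * R * J + (A - B * J)ᵀ * P * (A - B * J)
        = Q + Aᵀ * P * A + Jᵀ * ((R + Bᵀ * P * B) * J) - Jᵀ * (Bᵀ * P * A)
          - (Aᵀ * P * B) * J := by
    intro J
    simp only [transpose_sub, transpose_mul, Matrix.sub_mul, Matrix.mul_sub, Matrix.add_mul,
      Matrix.mul_add, Matrix.mul_assoc]
    abel
  rw [expand K, expand L, ← hLT, ← hL]
  simp only [transpose_sub, Matrix.sub_mul, Matrix.mul_sub, Matrix.mul_assoc]
  abel

theorem tendsto_apply_of_tendsto_quadForm {n : ℕ} {E : ℕ → Matrix (Fin n) (Fin n) ℝ}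
    (hE : ∀ i, (E i).IsSymm)
    (h : ∀ x : Fin n → ℝ, Tendsto (fun i => x ⬝ᵥ (E i *ᵥ x)) atTop (nhds 0)) (k l : Fin n) :
    Tendsto (fun i => E i k l) atTop (nhds 0) := by
  have hpol : ∀ i, E i k l = ((Pi.single k 1 + Pi.single l 1 : Fin n → ℝ) ⬝ᵥ
      (E i *ᵥ (Pi.single k 1 + Pi.single l 1))
      - (Pi.single k 1 : Fin n → ℝ) ⬝ᵥ (E i *ᵥ Pi.single k 1)
      - (Pi.single l 1 : Fin n → ℝ) ⬝ᵥ (E i *ᵥ Pi.single l 1)) / 2 := by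
    intro i
    have := (hE i).apply k l
    simp only [mulVec_add, add_dotProduct, dotProduct_add, mulVec_single_one,
      single_one_dotProduct, Matrix.col_apply]
    linarith
  have hlim := (((h (Pi.single k 1 + Pi.single l 1)).sub (h (Pi.single k 1))).sub
    (h (Pi.single l 1))).div_const 2
  rw [sub_zero, sub_zero, zero_div] at hlim
  exact hlim.congr fun i => (hpol i).symm

/-- A positive semidefinite sequence dominated by a stable Stein recursion converges to zero. -/
theorem OrbitsVanish.tendsto_of_contraction {n : ℕ} {M : Matrix (Fin n) (Fin n) ℝ}
    (hM : OrbitsVanish M) {E : ℕ → Matrix (Fin n) (Fin n) ℝ} (hE : ∀ i, (E i).PosSemidef)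
    (hstep : ∀ i, (Mᵀ * E i * M - E (i + 1)).PosSemidef) (k l : Fin n) :
    Tendsto (fun i => E i k l) atTop (nhds 0) := by
  refine tendsto_apply_of_tendsto_quadForm
    (fun i => (hE i).isSymm) (fun x => ?_) k l
  refine squeeze_zero (fun i => (hE i).quadForm_nonneg x) (fun i => ?_) (hM.tendsto_bilin (E 0) x)
  induction i generalizing x with
  | zero => simp
  | succ i ih =>
    have h1 := (hstep i).quadForm_nonneg x
    rw [sub_mulVec, dotProduct_sub, dotProduct_transpose_mul_mul] at h1
    have h2 := ih (M *ᵥ x)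
    rw [pow_succ, ← mulVec_mulVec]
    linarith

/-- Policy iteration started from a stabilizing gain converges to the positive definite solution
of the algebraic Riccati equation. -/
theorem tendsto_policyIteration {n m : ℕ}
    {A : Matrix (Fin n) (Fin n) ℝ} {B : Matrix (Fin n) (Fin m) ℝ}
    {Q : Matrix (Fin n) (Fin n) ℝ} {R : Matrix (Fin m) (Fin m) ℝ}
    (hQ : Q.PosSemidef) (hR : R.PosDef)
    (hObs : ∀ x : Fin n → ℝ, (∀ k : ℕ, Q.mulVec ((A ^ k).mulVec x) = 0) → x = 0)
    {K : ℕ → Matrix (Fin m) (Fin n) ℝ} {P : ℕ → Matrix (Fin n) (Fin n) ℝ}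
    (hK0 : OrbitsVanish (A - B * K 0)) (hPsymm : ∀ i, (P i).IsSymm)
    (hP : ∀ i, P i = Q + (K i)ᵀ * R * (K i) + (A - B * K i)ᵀ * (P i) * (A - B * K i))
    (hKupd : ∀ i, K (i + 1) = (R + Bᵀ * (P i) * B)⁻¹ * (Bᵀ * (P i) * A))
    {Pstar : Matrix (Fin n) (Fin n) ℝ} (hPstar : Pstar.PosDef)
    (hARE : Aᵀ * Pstar * A - Pstar
        - Aᵀ * Pstar * B * (R + Bᵀ * Pstar * B)⁻¹ * (Bᵀ * Pstar * A) + Q = 0) (k l : Fin n) :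
    Tendsto (fun i => P i k l) atTop (nhds (Pstar k l)) := by
  have hRs : R.IsSymm := hR.posSemidef.isSymm
  have hsS : Pstar.IsSymm := hPstar.posSemidef.isSymm
  have hSpos : ∀ X : Matrix (Fin n) (Fin n) ℝ, X.PosSemidef → (R + Bᵀ * X * B).PosDef :=
    fun X hX => hR.add_posSemidef (hX.transpose_mul_mul_same B)
  have hgain : ∀ X : Matrix (Fin n) (Fin n) ℝ, X.PosSemidef →
      (R + Bᵀ * X * B) * ((R + Bᵀ * X * B)⁻¹ * (Bᵀ * X * A)) = Bᵀ * X * A := fun X hX =>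
    mul_nonsing_inv_cancel_left _ _ ((isUnit_iff_isUnit_det _).1 (hSpos X hX).isUnit)
  set L := (R + Bᵀ * Pstar * B)⁻¹ * (Bᵀ * Pstar * A) with hLdef
  have hL : (R + Bᵀ * Pstar * B) * L = Bᵀ * Pstar * A := hgain _ hPstar.posSemidef
  have hsquare := fun J => policyCost_eq_add_sq (Q := Q) hRs hsS hL J
  have hstar : Pstar = Q + Lᵀ * R * L + (A - B * L)ᵀ * Pstar * (A - B * L) := by
    have h0 := hsquare 0
    have hLT : Lᵀ * (R + Bᵀ * Pstar * B) = Aᵀ * Pstar * B := by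
      have := congrArg transpose hL
      simpa [transpose_mul, hsS.eq, hRs.eq, Matrix.mul_assoc] using this
    simp only [zero_sub, transpose_neg, transpose_zero, Matrix.neg_mul, Matrix.mul_neg, neg_neg,
      Matrix.zero_mul, Matrix.mul_zero, add_zero, sub_zero, hLT] at h0
    rw [Matrix.mul_assoc (Aᵀ * Pstar * B), ← hLdef] at hARE
    rw [eq_sub_of_add_eq h0.symm, ← sub_eq_zero, ← neg_eq_zero, ← hARE]
    abel
  have hLstab : OrbitsVanish (A - B * L) :=
    (schurStable_closedLoop hQ hR hObs hPstar PosSemidef.zero (by simpa using hstar)).orbitsVanish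
  have hge : ∀ i, OrbitsVanish (A - B * K i) → (P i - Pstar).PosSemidef := by
    intro i hi
    refine hi.posSemidef_of_stein ((hPsymm i).sub hsS)
      ((hSpos _ hPstar.posSemidef).posSemidef.transpose_mul_mul_same (K i - L)) ?_
    have h1 := hsquare (K i)
    rw [← hstar] at h1
    have h2 := hP i
    rw [transpose_mul_sub_mul]
    rw [eq_sub_of_add_eq' h1.symm]
    nth_rewrite 1 [h2]
    abel
  have hposOf : ∀ i, OrbitsVanish (A - B * K i) → (P i).PosDef := by
    intro i hi
    simpa using hPstar.add_posSemidef (hge i hi)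
  have hsq : ∀ i, OrbitsVanish (A - B * K i) → ∀ J, _ := fun i hi J =>
    policyCost_eq_add_sq (A := A) (B := B) (Q := Q) hRs (hPsymm i)
      (L := K (i + 1)) (by rw [hKupd i]; exact hgain _ (hposOf i hi).posSemidef) J
  have hstab : ∀ i, OrbitsVanish (A - B * K i) := by
    intro i
    induction i with
    | zero => exact hK0
    | succ i ih =>
      exact (schurStable_closedLoop hQ hR hObs (hposOf i ih)
        ((hSpos _ (hposOf i ih).posSemidef).posSemidef.transpose_mul_mul_same (K i - K (i + 1)))
        ((hP i).trans (hsq i ih (K i)))).orbitsVanish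
  have hS : ∀ i, (R + Bᵀ * P i * B).PosSemidef := fun i =>
    (hSpos _ (hposOf i (hstab i)).posSemidef).posSemidef
  have hmono : ∀ i, (P i - P (i + 1)).PosSemidef := by
    intro i
    refine (hstab (i + 1)).posSemidef_of_stein ((hPsymm i).sub (hPsymm (i + 1)))
      ((hS i).transpose_mul_mul_same (K i - K (i + 1))) ?_
    have h1 := (hP i).trans (hsq i (hstab i) (K i))
    have h2 := hP (i + 1)
    rw [transpose_mul_sub_mul]
    nth_rewrite 1 [h1]
    nth_rewrite 1 [h2]
    abel
  have hcontr : ∀ i, ((A - B * L)ᵀ * (P i - Pstar) * (A - B * L)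
      - (P (i + 1) - Pstar)).PosSemidef := by
    intro i
    have h1 := hsq i (hstab i) L
    have h2 := hP (i + 1)
    have heq : (A - B * L)ᵀ * (P i - Pstar) * (A - B * L) - (P (i + 1) - Pstar)
        = (A - B * K (i + 1))ᵀ * (P i - P (i + 1)) * (A - B * K (i + 1))
          + (L - K (i + 1))ᵀ * (R + Bᵀ * P i * B) * (L - K (i + 1)) := by
      rw [transpose_mul_sub_mul, transpose_mul_sub_mul]
      rw [eq_sub_of_add_eq' h1]
      nth_rewrite 1 [h2]
      nth_rewrite 2 [hstar]
      abel
    rw [heq]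
    exact ((hmono i).transpose_mul_mul_same _).add ((hS i).transpose_mul_mul_same _)
  have hlim := hLstab.tendsto_of_contraction (E := fun i => P i - Pstar)
    (fun i => hge i (hstab i)) hcontr k l
  simpa using hlim.add_const (Pstar k l)

theorem stmt_9 {n m : ℕ}
    (A : Matrix (Fin n) (Fin n) ℝ) (B : Matrix (Fin n) (Fin m) ℝ)
    (Q : Matrix (Fin n) (Fin n) ℝ) (R : Matrix (Fin m) (Fin m) ℝ)
    (hQ : Q.PosSemidef) (hR : R.PosDef)
    (hObs : ∀ x : Fin n → ℝ, (∀ k : ℕ, Q.mulVec ((A ^ k).mulVec x) = 0) → x = 0)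
    (K : ℕ → Matrix (Fin m) (Fin n) ℝ) (P : ℕ → Matrix (Fin n) (Fin n) ℝ)
    (c : ℕ → ℝ) (b : ℝ) (hb : 0 < b)
    (hK0 : SchurStable ((1 / b) • (A - B * K 0)))
    (hc0 : c 0 = 1)
    (γ : ℕ → ℝ)
    (hγ : ∀ i, γ i = (∏ j ∈ Finset.range (i + 1), c j) / b)
    (ihat : ℕ) (hihat : b ≤ ∏ j ∈ Finset.range (ihat + 1), c j)
    -- the scaled iteration, before index `ihat`
    (hPpos : ∀ i < ihat, (P i).PosDef)
    (hPscaled : ∀ i < ihat,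
      (γ i) ^ 2 • ((A - B * K i)ᵀ * (P i) * (A - B * K i)) - P i + Q
        + (K i)ᵀ * R * (K i) = 0)
    (hKscaled : ∀ i < ihat,
      K (i + 1) = (Bᵀ * (P i) * B + (1 / (γ i) ^ 2) • R)⁻¹ * (Bᵀ * (P i) * A))
    (hc : ∀ i < ihat, 1 < c (i + 1) ∧
      SchurStable ((c (i + 1) * γ i) • (A - B * K (i + 1))))
    -- the unscaled policy iteration, from index `ihat` on
    (hPsymm : ∀ i, ihat ≤ i → (P i).IsSymm)
    (hP : ∀ i, ihat ≤ i →
      P i = Q + (K i)ᵀ * R * (K i) + (A - B * K i)ᵀ * (P i) * (A - B * K i))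
    (hKupd : ∀ i, ihat ≤ i →
      K (i + 1) = (R + Bᵀ * (P i) * B)⁻¹ * (Bᵀ * (P i) * A))
    (Pstar : Matrix (Fin n) (Fin n) ℝ) (hPstar : Pstar.PosDef)
    (hARE : Aᵀ * Pstar * A - Pstar
        - Aᵀ * Pstar * B * (R + Bᵀ * Pstar * B)⁻¹ * (Bᵀ * Pstar * A) + Q = 0) :
    ∀ k l, Tendsto (fun i => P i k l) atTop (nhds (Pstar k l)) := by
  have hstab : OrbitsVanish (A - B * K ihat) := by
    have hγ1 : 1 ≤ γ ihat := by
      rw [hγ, one_le_div hb]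
      exact hihat
    refine .of_smul hγ1 (SchurStable.orbitsVanish ?_)
    cases ihat with
    | zero => simpa [hγ, hc0] using hK0
    | succ j =>
      have hγj : γ (j + 1) = c (j + 1) * γ j := by
        rw [hγ, hγ, Finset.prod_range_succ _ (j + 1)]
        ring
      rw [hγj]
      exact (hc j (Nat.lt_succ_self j)).2
  intro k l
  rw [← tendsto_add_atTop_iff_nat ihat]
  refine tendsto_policyIteration hQ hR hObs (K := fun i => K (i + ihat))
    (P := fun i => P (i + ihat)) (by simpa using hstab) (fun i => hPsymm _ (Nat.le_add_left _ _))
    (fun i => hP _ (Nat.le_add_left _ _)) (fun i => ?_) hPstar hARE k l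
  have h := hKupd (i + ihat) (Nat.le_add_left _ _)
  rwa [add_right_comm] at h
end

section
/- Let γ > 0 and let K₊ be an m×n real matrix such that γ(A − BK₊) is Schur stable. Let P̄ be a symmetric positive definite matrix satisfying γ²(A − BK₊)ᵀP̄(A − BK₊) − P̄ + Q + K₊ᵀRK₊ = 0, and let P̃ be a symmetric positive definite matrix with P̄ ≤ P̃. Suppose the matrix Q̃ = P̃ − Q − K₊ᵀRK₊ is invertible, and let c be a real number with 1 < c and c² < σ_min(P̃Q̃⁻¹), where σ_min denotes the smallest singular value (i.e. c²‖x‖ < ‖(P̃Q̃⁻¹)x‖ for every nonzero x ∈ ℝⁿ, in the Euclidean norm). Then cγ(A − BK₊) is Schur stable. -/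
open Matrix

/-- The Euclidean norm of a vector in `Fin n → ℝ`. -/
noncomputable def euclNorm {n : ℕ} (x : Fin n → ℝ) : ℝ :=
  ‖(WithLp.equiv 2 (Fin n → ℝ)).symm x‖

theorem Matrix.PosSemidef.posDef_sub_of_mulVec_dotProduct_lt {n : ℕ}
    {S T : Matrix (Fin n) (Fin n) ℝ} (hS : S.PosSemidef) (hT : T.PosSemidef)
    (h : ∀ x : Fin n → ℝ, x ≠ 0 → (T *ᵥ x) ⬝ᵥ (T *ᵥ x) < (S *ᵥ x) ⬝ᵥ (S *ᵥ x)) :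
    (S - T).PosDef := by
  have hH : (S - T).IsHermitian := hS.1.sub hT.1
  rw [hH.posDef_iff_eigenvalues_pos]
  intro i
  by_contra! hi
  have hv := hH.mulVec_eigenvectorBasis i
  have hv0 : (hH.eigenvectorBasis i).ofLp ≠ 0 := fun h0 =>
    hH.eigenvectorBasis.orthonormal.ne_zero i (by ext j; exact congrFun h0 j)
  generalize (hH.eigenvectorBasis i).ofLp = v at hv hv0
  have hST : S *ᵥ v = T *ᵥ v + hH.eigenvalues i • v := by
    rw [← hv, sub_mulVec, add_sub_cancel]
  have hlt := h v hv0
  have hSv : 0 ≤ v ⬝ᵥ (S *ᵥ v) := by simpa using hS.dotProduct_mulVec_nonneg v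
  have hTv : 0 ≤ v ⬝ᵥ (T *ᵥ v) := by simpa using hT.dotProduct_mulVec_nonneg v
  have key : (S *ᵥ v) ⬝ᵥ (S *ᵥ v) - (T *ᵥ v) ⬝ᵥ (T *ᵥ v)
      = hH.eigenvalues i * (v ⬝ᵥ (S *ᵥ v) + v ⬝ᵥ (T *ᵥ v)) := by
    rw [hST]
    simp only [dotProduct_add, add_dotProduct, smul_dotProduct, dotProduct_smul, smul_eq_mul,
      dotProduct_comm (T *ᵥ v) v]
    ring
  nlinarith [mul_nonneg (neg_nonneg.mpr hi) (add_nonneg hSv hTv)]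

/-- A discrete-time Lyapunov inequality implies Schur stability. -/
theorem SchurStable.of_posDef_sub {n : ℕ} {N P : Matrix (Fin n) (Fin n) ℝ} (hP : P.PosDef)
    (h : (P - Nᵀ * P * N).PosDef) : SchurStable N := by
  intro μ hμ
  rw [← spectrum_toLin'] at hμ
  obtain ⟨v, hv⟩ := (Module.End.hasEigenvalue_iff_mem_spectrum.mpr hμ).exists_hasEigenvector
  have hNv : (N.map (algebraMap ℝ ℂ)) *ᵥ v = μ • v := by
    simpa [toLin'_apply] using hv.apply_eq_smul
  set a : Fin n → ℝ := fun i => (v i).re with ha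
  set b : Fin n → ℝ := fun i => (v i).im with hb
  have hNa : N *ᵥ a = μ.re • a - μ.im • b := by
    ext i
    simpa [mulVec, dotProduct, ha, hb] using congrArg Complex.re (congrFun hNv i)
  have hNb : N *ᵥ b = μ.im • a + μ.re • b := by
    ext i
    have := congrArg Complex.im (congrFun hNv i)
    simp [mulVec, dotProduct, ha, hb] at this ⊢
    linarith
  have hab : a ≠ 0 ∨ b ≠ 0 := by
    by_contra! hc
    exact hv.2 (funext fun i => Complex.ext (congrFun hc.1 i) (congrFun hc.2 i))
  have hquad (x : Fin n → ℝ) : x ⬝ᵥ ((P - Nᵀ * P * N) *ᵥ x)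
      = x ⬝ᵥ (P *ᵥ x) - (N *ᵥ x) ⬝ᵥ (P *ᵥ (N *ᵥ x)) := by
    rw [sub_mulVec, dotProduct_sub, ← mulVec_mulVec, ← mulVec_mulVec, dotProduct_mulVec x Nᵀ,
      vecMul_transpose]
  have hsymm : b ⬝ᵥ (P *ᵥ a) = a ⬝ᵥ (P *ᵥ b) := by
    rw [dotProduct_mulVec, ← mulVec_transpose, dotProduct_comm,
      show Pᵀ = P by simpa using hP.1.eq]
  have nonneg {X : Matrix (Fin n) (Fin n) ℝ} (hX : X.PosDef) (x : Fin n → ℝ) :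
      0 ≤ x ⬝ᵥ (X *ᵥ x) := by
    simpa using hX.posSemidef.dotProduct_mulVec_nonneg x
  have pos {X : Matrix (Fin n) (Fin n) ℝ} (hX : X.PosDef) :
      0 < a ⬝ᵥ (X *ᵥ a) + b ⬝ᵥ (X *ᵥ b) := by
    rcases hab with h0 | h0
    · exact add_pos_of_pos_of_nonneg (by simpa using hX.dotProduct_mulVec_pos h0) (nonneg hX b)
    · exact add_pos_of_nonneg_of_pos (nonneg hX a) (by simpa using hX.dotProduct_mulVec_pos h0)
  have hpos := pos h
  have hPpos := pos hP
  have key : a ⬝ᵥ ((P - Nᵀ * P * N) *ᵥ a) + b ⬝ᵥ ((P - Nᵀ * P * N) *ᵥ b)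
      = (1 - ‖μ‖ ^ 2) * (a ⬝ᵥ (P *ᵥ a) + b ⬝ᵥ (P *ᵥ b)) := by
    rw [hquad, hquad, hNa, hNb, Complex.sq_norm, Complex.normSq_apply]
    simp only [mulVec_add, mulVec_sub, mulVec_smul, dotProduct_add, add_dotProduct,
      dotProduct_sub, sub_dotProduct, smul_dotProduct, dotProduct_smul, smul_eq_mul, hsymm]
    ring
  rw [key] at hpos
  have := (pos_iff_pos_of_mul_pos hpos).mpr hPpos
  nlinarith [norm_nonneg μ]

theorem euclNorm_sq {n : ℕ} (x : Fin n → ℝ) : euclNorm x ^ 2 = x ⬝ᵥ x := by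
  rw [euclNorm, EuclideanSpace.real_norm_sq_eq]
  simp [dotProduct, sq]

theorem stmt_12 {n m : ℕ}
    (A : Matrix (Fin n) (Fin n) ℝ) (B : Matrix (Fin n) (Fin m) ℝ)
    (Q : Matrix (Fin n) (Fin n) ℝ) (R : Matrix (Fin m) (Fin m) ℝ)
    (hQ : Q.PosSemidef) (hR : R.PosDef)
    (γ : ℝ) (hγ : 0 < γ)
    (Kplus : Matrix (Fin m) (Fin n) ℝ)
    (hKplus : SchurStable (γ • (A - B * Kplus)))
    (Pbar : Matrix (Fin n) (Fin n) ℝ) (hPbar : Pbar.PosDef)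
    (hPbarEq : γ ^ 2 • ((A - B * Kplus)ᵀ * Pbar * (A - B * Kplus)) - Pbar + Q
        + Kplusᵀ * R * Kplus = 0)
    (Ptil : Matrix (Fin n) (Fin n) ℝ) (hPtil : Ptil.PosDef)
    (hle : (Ptil - Pbar).PosSemidef)
    (Qtil : Matrix (Fin n) (Fin n) ℝ)
    (hQtil : Qtil = Ptil - Q - Kplusᵀ * R * Kplus)
    (hQtilInv : IsUnit Qtil)
    (c : ℝ) (hc1 : 1 < c)
    (hc2 : ∀ x : Fin n → ℝ, x ≠ 0 →
      c ^ 2 * euclNorm x < euclNorm ((Ptil * Qtil⁻¹).mulVec x)) :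
    SchurStable ((c * γ) • (A - B * Kplus)) := by
  have hclosed : γ ^ 2 • ((A - B * Kplus)ᵀ * Pbar * (A - B * Kplus))
      = Pbar - Q - Kplusᵀ * R * Kplus := by
    rw [← sub_eq_zero, ← hPbarEq]; abel
  have hQtilPSD : Qtil.PosSemidef := by
    have h1 : (γ ^ 2 • ((A - B * Kplus)ᵀ * Pbar * (A - B * Kplus))).PosSemidef := by
      simpa using (hPbar.posSemidef.conjTranspose_mul_mul_same (A - B * Kplus)).smul (sq_nonneg γ)
    have h2 := hle.add h1
    rw [hclosed] at h2
    convert h2 using 1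
    rw [hQtil]; abel
  have hc0 : 0 ≤ c ^ 2 := sq_nonneg c
  have hS : (Ptil - c ^ 2 • Qtil).PosDef := by
    refine hPtil.posSemidef.posDef_sub_of_mulVec_dotProduct_lt (hQtilPSD.smul hc0) fun x hx => ?_
    have hdet : IsUnit Qtil.det := (isUnit_iff_isUnit_det _).mp hQtilInv
    have hx' : Qtil *ᵥ x ≠ 0 := fun h0 =>
      hx (mulVec_injective_of_isUnit hQtilInv (by simpa using h0))
    have hlt := hc2 (Qtil *ᵥ x) hx'
    rw [mulVec_mulVec, nonsing_inv_mul_cancel_right _ _ hdet] at hlt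
    have hsq := pow_lt_pow_left₀ hlt (mul_nonneg hc0 (norm_nonneg _)) two_ne_zero
    rw [mul_pow, euclNorm_sq, euclNorm_sq] at hsq
    simp only [smul_mulVec, smul_dotProduct, dotProduct_smul, smul_eq_mul]
    linarith
  refine SchurStable.of_posDef_sub hPbar ?_
  have hc : 0 ≤ c ^ 2 - 1 := by nlinarith
  convert hS.add_posSemidef (hle.smul hc) using 1
  have hscale : ((c * γ) • (A - B * Kplus))ᵀ * Pbar * ((c * γ) • (A - B * Kplus))
      = c ^ 2 • (Pbar - Q - Kplusᵀ * R * Kplus) := by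
    rw [← hclosed, transpose_smul, smul_mul, smul_mul, Matrix.mul_smul, smul_smul, smul_smul]
    congr 1
    ring
  rw [hscale, hQtil]
  module
end
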